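/- Let K be a tensor-triangulated category with unit 𝟙, let f : c → 𝟙 be a morphism with f^{⊗n} = 0 for some n ≥ 1, and let e be a cone of f, i.e. there is a distinguished triangle c → 𝟙 → e → c[1]. Then 𝟙 lies in the tt-ideal generated by e; in particular ⟨e⟩ = K, and ⟨e⟩ coincides with the tt-ideal generated by c together with 𝟙. -/

import Mathlib

open CategoryTheory CategoryTheory.Limits CategoryTheory.Pretriangulated
  CategoryTheory.MonoidalCategory

universe v u

variable {C : Type u} [Category.{v} C] [HasZeroObject C] [Preadditive C] [HasShift C ℤ]
  [∀ n : ℤ, (shiftFunctor C n).Additive] [Pretriangulated C] [MonoidalCategory C]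

/-- The tensor product `X 0 ⊗ X 1 ⊗ ⋯ ⊗ X (m-1)` of a finite family of objects
(the empty tensor product being the monoidal unit). -/
def tensorFam : ∀ {m : ℕ}, (Fin m → C) → C
  | 0, _ => 𝟙_ C
  | m + 1, X => tensorFam (fun k : Fin m => X k.castSucc) ⊗ X (Fin.last m)

/-- The tensor product `f 0 ⊗ f 1 ⊗ ⋯ ⊗ f (m-1)` of a finite family of morphisms. -/
def tensorFamHom : ∀ {m : ℕ} {X Y : Fin m → C},
    (∀ k, X k ⟶ Y k) → (tensorFam X ⟶ tensorFam Y)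
  | 0, _, _, _ => 𝟙 (𝟙_ C)
  | _ + 1, _, _, f =>
    MonoidalCategory.tensorHom (tensorFamHom fun k => f k.castSucc) (f (Fin.last _))

/-- A tt-ideal of a tensor-triangulated category, rendered as a predicate on objects:
it contains the zero objects, is closed under isomorphisms, shifts, cones, direct
summands, and tensoring with arbitrary objects. -/
structure IsTTIdeal (P : C → Prop) : Prop where
  zero : ∀ X : C, IsZero X → P X
  isoClosed : ∀ {X Y : C}, (X ≅ Y) → P X → P Y
  shift : ∀ (X : C) (n : ℤ), P X → P (X⟦n⟧)
  ext : ∀ T ∈ distTriang C, P T.obj₁ → P T.obj₂ → P T.obj₃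
  summand : ∀ {X Y : C}, P Y → ∀ (i : X ⟶ Y) (r : Y ⟶ X), i ≫ r = 𝟙 X → P X
  tensorClosed : ∀ (X Y : C), P X → P (X ⊗ Y)
  tensorClosed' : ∀ (X Y : C), P X → P (Y ⊗ X)

/-- `X` belongs to the tt-ideal generated by the collection `S` of objects. -/
def InTTIdealGen (S : Set C) (X : C) : Prop :=
  ∀ P : C → Prop, IsTTIdeal P → (∀ s ∈ S, P s) → P X


lemma IsTTIdeal.obj₁ {P : C → Prop} (hP : IsTTIdeal P) (T : Triangle C) (hT : T ∈ distTriang C)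
    (h₂ : P T.obj₂) (h₃ : P T.obj₃) : P T.obj₁ := by
  have h := hP.ext _ (rot_of_distTriang _ hT) h₂ h₃
  exact hP.isoClosed ((shiftShiftNeg T.obj₁ (1 : ℤ))) (hP.shift _ (-1) h)

/-- `u` factors through an object of `P`. -/
def FacThrough (P : C → Prop) {A B : C} (u : A ⟶ B) : Prop :=
  ∃ (Z : C) (a : A ⟶ Z) (b : Z ⟶ B), P Z ∧ a ≫ b = u

lemma FacThrough.lift {P : C → Prop} (hP : IsTTIdeal P) (T : Triangle C) (hT : T ∈ distTriang C)
    (h₃ : P T.obj₃) {A : C} (u : A ⟶ T.obj₁) (hu : FacThrough P (u ≫ T.mor₁)) :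
    FacThrough P u := by
  obtain ⟨Z, α, β, hZ, hαβ⟩ := hu
  obtain ⟨W, w, d, hW⟩ := distinguished_cocone_triangle₁ (β ≫ T.mor₂)
  obtain ⟨b, hb₁, hb₂⟩ := complete_distinguished_triangle_morphism₁ _ _ hW hT β (𝟙 _)
    (Category.comp_id _)
  have PW : P W := hP.obj₁ _ hW hZ h₃
  obtain ⟨α', hα'⟩ := Triangle.coyoneda_exact₂ _ hW α (by
    change α ≫ β ≫ T.mor₂ = 0
    rw [reassoc_of% hαβ, comp_distTriang_mor_zero₁₂ _ hT, comp_zero])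
  change W ⟶ T.obj₁ at b
  change w ≫ β = b ≫ T.mor₁ at hb₁
  change d ≫ b⟦(1 : ℤ)⟧' = 𝟙 T.obj₃ ≫ T.mor₃ at hb₂
  change A ⟶ W at α'
  change α = α' ≫ w at hα'
  obtain ⟨k, hk⟩ := Triangle.coyoneda_exact₁ _ hT ((u - α' ≫ b)⟦(1 : ℤ)⟧') (by
    rw [← Functor.map_comp, Preadditive.sub_comp, Category.assoc, ← hb₁, ← Category.assoc,
      ← hα', hαβ, sub_self, Functor.map_zero])
  obtain ⟨l, hl⟩ := (shiftFunctor C (1 : ℤ)).map_surjective (k ≫ d)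
  refine ⟨W, α' + l, b, PW, ?_⟩
  apply (shiftFunctor C (1 : ℤ)).map_injective
  have h2 : T.mor₃ = d ≫ b⟦(1 : ℤ)⟧' := by simpa using hb₂.symm
  rw [h2, ← Category.assoc, ← hl, ← Functor.map_comp] at hk
  rw [Preadditive.add_comp, Functor.map_add, ← hk, ← Functor.map_add]
  congr 1
  abel

section
variable [∀ X : C, (tensorLeft X).CommShift ℤ] [∀ X : C, (tensorLeft X).IsTriangulated]

lemma facThrough_step {P : C → Prop} (hP : IsTTIdeal P) {c e : C} (f : c ⟶ 𝟙_ C)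
    (g : 𝟙_ C ⟶ e) (h : e ⟶ c⟦(1 : ℤ)⟧) (hT : Triangle.mk f g h ∈ distTriang C) (he : P e)
    {X Y : C} (t : X ⟶ Y)
    (ih : ∀ {A : C} (u : A ⟶ X), FacThrough P (u ≫ t) → FacThrough P u)
    {A : C} (u : A ⟶ X ⊗ c) (hu : FacThrough P (u ≫ (t ⊗ₘ f))) : FacThrough P u := by
  have key : FacThrough P (u ≫ X ◁ f) := by
    obtain ⟨Z, a, b, hZ, hab⟩ := hu
    obtain ⟨Z, a, b, hZ, hab⟩ := ih (u ≫ (X ◁ f) ≫ (ρ_ _).hom)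
      ⟨Z, a, b ≫ (ρ_ _).hom, hZ, by
        rw [reassoc_of% hab, tensorHom_def']
        simp⟩
    refine ⟨Z, a, b ≫ (ρ_ _).inv, hZ, ?_⟩
    rw [reassoc_of% hab]
    simp
  exact FacThrough.lift hP _ ((tensorLeft X).map_distinguished _ hT)
    (hP.tensorClosed' _ _ he) u key

lemma facThrough_tensorFam {P : C → Prop} (hP : IsTTIdeal P) {c e : C} (f : c ⟶ 𝟙_ C)
    (g : 𝟙_ C ⟶ e) (h : e ⟶ c⟦(1 : ℤ)⟧) (hT : Triangle.mk f g h ∈ distTriang C) (he : P e)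
    (m : ℕ) : ∀ {A : C} (u : A ⟶ tensorFam (fun _ : Fin m => c)),
      FacThrough P (u ≫ tensorFamHom (fun _ : Fin m => f)) → FacThrough P u := by
  induction m with
  | zero =>
    intro A u hu
    simp only [tensorFamHom] at hu
    erw [Category.comp_id] at hu
    exact hu
  | succ m ih =>
    intro A u hu
    exact facThrough_step hP f g h hT he _ ih u hu

lemma unit_mem {P : C → Prop} (hP : IsTTIdeal P) {c e : C} (f : c ⟶ 𝟙_ C)
    (g : 𝟙_ C ⟶ e) (h : e ⟶ c⟦(1 : ℤ)⟧) (hT : Triangle.mk f g h ∈ distTriang C) (he : P e)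
    (m : ℕ) (hm : P (tensorFam (fun _ : Fin m => c))) : P (𝟙_ C) := by
  induction m with
  | zero => exact hm
  | succ m ih =>
    refine ih ?_
    have hD := (tensorLeft (tensorFam (fun _ : Fin m => c))).map_distinguished _ hT
    have h2 := hP.obj₁ _ (rot_of_distTriang _ hD)
      (hP.tensorClosed' _ _ he) (hP.shift _ 1 hm)
    exact hP.isoClosed (ρ_ _) h2
end

/-- Let `K` be a tensor-triangulated category with unit `𝟙`, let `f : c ⟶ 𝟙`
be a morphism with `f^{⊗n} = 0` for some `n ≥ 1`, and let `e` be a cone of `f`, i.e. there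
is a distinguished triangle `c ⟶ 𝟙 ⟶ e ⟶ c[1]`. Then `𝟙` lies in the tt-ideal generated
by `e`; in particular `⟨e⟩ = K`, and `⟨e⟩` coincides with the tt-ideal generated by `c`
together with `𝟙`. -/
theorem stmt3 [∀ X : C, (tensorLeft X).CommShift ℤ] [∀ X : C, (tensorLeft X).IsTriangulated]
    [∀ X : C, (tensorRight X).CommShift ℤ] [∀ X : C, (tensorRight X).IsTriangulated]
    (c : C) (f : c ⟶ 𝟙_ C) (n : ℕ) (hn : 1 ≤ n)
    (hf : tensorFamHom (fun _ : Fin n => f) = 0)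
    (e : C) (g : 𝟙_ C ⟶ e) (h : e ⟶ c⟦(1 : ℤ)⟧)
    (hT : Triangle.mk f g h ∈ distTriang C) :
    InTTIdealGen {e} (𝟙_ C) ∧ (∀ X : C, InTTIdealGen {e} X) ∧
    (∀ X : C, InTTIdealGen {e} X ↔ InTTIdealGen {c, 𝟙_ C} X) := by
  have h1 : InTTIdealGen {e} (𝟙_ C) := by
    intro P hP hs
    have he : P e := hs e rfl
    refine unit_mem hP f g h hT he n ?_
    obtain ⟨Z, a, b, hZ, hab⟩ := facThrough_tensorFam hP f g h hT he n (𝟙 _)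
      ⟨e, 0, 0, he, by rw [hf]; simp⟩
    exact hP.summand hZ a b hab
  have h2 : ∀ X : C, InTTIdealGen {e} X := fun X P hP hs =>
    hP.isoClosed (λ_ X) (hP.tensorClosed _ X (h1 P hP hs))
  refine ⟨h1, h2, fun X => ⟨fun _ P hP hs => ?_, fun _ => h2 X⟩⟩
  exact hP.isoClosed (λ_ X) (hP.tensorClosed _ X (hs _ (by simp)))
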